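/- Let R = [r] × [s] and let x, z ∈ ℝ_{>0}^R. Suppose z satisfies the chain-shifting property with respect to x: w_{[1,r]×[u−1,v−1]}^{(k)}(z) = w_{[1,r]×[u,v]}^{(k)}(x) for all 1 < u ≤ v ≤ s and all k ≥ 1, and w_{[u−1,v−1]×[1,s]}^{(k)}(z) = w_{[u,v]×[1,s]}^{(k)}(x) for all 1 < u ≤ v ≤ r and all k ≥ 1. Then RSK(z)_{ij} = RSK(φ(ρ⁻¹(φ⁻¹(x))))_{ij} for every (i,j) ∈ R with j − i ≠ s − r. -/

import Mathlib

namespace Paper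

/-- Membership in the rectangle poset `R = [1,r] × [1,s]` (coordinates in `ℤ`). -/
def inR (r s : ℕ) (p : ℤ × ℤ) : Prop :=
  1 ≤ p.1 ∧ p.1 ≤ (r : ℤ) ∧ 1 ≤ p.2 ∧ p.2 ≤ (s : ℤ)

instance (r s : ℕ) : DecidablePred (inR r s) := fun _ => by unfold inR; infer_instance

/-- The cover relation in the product of two chains. -/
def CoverStep (p q : ℤ × ℤ) : Prop :=
  (q.1 = p.1 + 1 ∧ q.2 = p.2) ∨ (q.1 = p.1 ∧ q.2 = p.2 + 1)

/-- Upper covers of `p` inside the rectangle. -/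
def upSet (r s : ℕ) (p : ℤ × ℤ) : Finset (ℤ × ℤ) :=
  ({(p.1 + 1, p.2), (p.1, p.2 + 1)} : Finset (ℤ × ℤ)).filter (inR r s)

/-- Lower covers of `p` inside the rectangle. -/
def downSet (r s : ℕ) (p : ℤ × ℤ) : Finset (ℤ × ℤ) :=
  ({(p.1 - 1, p.2), (p.1, p.2 - 1)} : Finset (ℤ × ℤ)).filter (inR r s)

/-- Sum of the labels of the lower covers of `p` (empty sum = 1). -/
noncomputable def dsum (r s : ℕ) (x : ℤ × ℤ → ℝ) (p : ℤ × ℤ) : ℝ :=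
  if (downSet r s p).Nonempty then ∑ q ∈ downSet r s p, x q else 1

/-- Parallel sum of the labels of the upper covers of `p` (empty parallel sum = 1). -/
noncomputable def usum (r s : ℕ) (x : ℤ × ℤ → ℝ) (p : ℤ × ℤ) : ℝ :=
  if (upSet r s p).Nonempty then (∑ q ∈ upSet r s p, (x q)⁻¹)⁻¹ else 1

/-- The birational toggle at `p`. -/
noncomputable def toggle (r s : ℕ) (p : ℤ × ℤ) (x : ℤ × ℤ → ℝ) : ℤ × ℤ → ℝ :=
  fun q => if q = p then usum r s x p * dsum r s x p / x p else x q

/-- The elements of `[1,a] × [1,b]` listed from top to bottom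
(descending lexicographic order, the reverse of a linear extension). -/
def rectList (a b : ℕ) : List (ℤ × ℤ) :=
  (List.range a).reverse.flatMap fun i =>
    (List.range b).reverse.map fun j => ((i : ℤ) + 1, (j : ℤ) + 1)

/-- Birational rowmotion on the rectangle: toggles from top to bottom. -/
noncomputable def rho (r s : ℕ) (x : ℤ × ℤ → ℝ) : ℤ × ℤ → ℝ :=
  (rectList r s).foldl (fun y p => toggle r s p y) x

/-- Inverse birational rowmotion: toggles from bottom to top. -/
noncomputable def rhoInv (r s : ℕ) (x : ℤ × ℤ → ℝ) : ℤ × ℤ → ℝ :=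
  (rectList r s).reverse.foldl (fun y p => toggle r s p y) x

/-- Integer powers of birational rowmotion. -/
noncomputable def rhoPow (r s : ℕ) (k : ℤ) (x : ℤ × ℤ → ℝ) : ℤ × ℤ → ℝ :=
  if 0 ≤ k then (rho r s)^[k.toNat] x else (rhoInv r s)^[(-k).toNat] x

/-- Saturated chains from `a` to `b`, as lists of successive cover steps. -/
def ChainList (a b : ℤ × ℤ) : Type :=
  {l : List (ℤ × ℤ) // l.Chain' CoverStep ∧ l.head? = some a ∧ l.getLast? = some b}

/-- The inverse birational transfer map on the rectangle: `φ⁻¹(x)_p` is the total weight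
of all saturated chains from the minimal element `(1,1)` to `p`. -/
noncomputable def phiInv (x : ℤ × ℤ → ℝ) : ℤ × ℤ → ℝ :=
  fun p => ∑ᶠ c : ChainList (1, 1) p, (c.1.map x).prod

/-- The birational transfer map `φ(x)_p = x_p / ∑_{q ⋖ p} x_q`. -/
noncomputable def phi (r s : ℕ) (x : ℤ × ℤ → ℝ) : ℤ × ℤ → ℝ :=
  fun p => x p / dsum r s x p

/-- A collection of `k` pairwise vertex-disjoint lattice paths in the interval
`[i₁,i₂] × [j₁,j₂]`, from `(i₁,j₁),…,(i₁,j₁+k-1)` to `(i₂,j₂-k+1),…,(i₂,j₂)`. -/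
structure RSys (i₁ i₂ j₁ j₂ : ℤ) (k : ℕ) where
  path : Fin k → List (ℤ × ℤ)
  chain : ∀ t, (path t).Chain' CoverStep
  mem : ∀ t, ∀ v ∈ path t, i₁ ≤ v.1 ∧ v.1 ≤ i₂ ∧ j₁ ≤ v.2 ∧ v.2 ≤ j₂
  first : ∀ t : Fin k, (path t).head? = some (i₁, j₁ + ((t : ℕ) : ℤ))
  final : ∀ t : Fin k, (path t).getLast? = some (i₂, j₂ - k + 1 + ((t : ℕ) : ℤ))
  disjoint : ∀ t t' : Fin k, t ≠ t' → ∀ v ∈ path t, v ∉ path t'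

/-- The weight of a collection of paths: the product of labels of all its elements. -/
noncomputable def RSysWeight (x : ℤ × ℤ → ℝ) {i₁ i₂ j₁ j₂ : ℤ} {k : ℕ}
    (L : RSys i₁ i₂ j₁ j₂ k) : ℝ :=
  ∏ t : Fin k, ((L.path t).map x).prod

/-- `w_I^{(k)}(x)`: total weight of all collections of `k` nonintersecting paths in the
interval `I = [i₁,i₂] × [j₁,j₂]` (with `w_I^{(0)} = 1`). -/
noncomputable def w (i₁ i₂ j₁ j₂ : ℤ) (k : ℤ) (x : ℤ × ℤ → ℝ) : ℝ :=
  if k ≤ 0 then 1 else ∑ᶠ L : RSys i₁ i₂ j₁ j₂ k.toNat, RSysWeight x L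

/-- `w_I(x)`: the product of all labels in the interval `I = [i₁,i₂] × [j₁,j₂]`. -/
noncomputable def wProd (i₁ i₂ j₁ j₂ : ℤ) (x : ℤ × ℤ → ℝ) : ℝ :=
  ∏ p ∈ Finset.Icc i₁ i₂ ×ˢ Finset.Icc j₁ j₂, x p

/-- The directed edges of the graph `𝒢_R` on vertex set `[1,r+1] × [1,s]`:
`(i,j) → (i+1,j)` for `(i,j) ∈ R`, and `(i,j) → (i+1,j-1)` when valid. -/
def GEdge (r s : ℕ) (p q : ℤ × ℤ) : Prop :=
  1 ≤ p.1 ∧ p.1 ≤ (r : ℤ) ∧ 1 ≤ p.2 ∧ p.2 ≤ (s : ℤ) ∧ q.1 = p.1 + 1 ∧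
    (q.2 = p.2 ∨ (q.2 = p.2 - 1 ∧ 2 ≤ p.2))

/-- The weight of an edge of `𝒢_R`: `x_p⁻¹` for vertical edges, `1` for diagonal ones. -/
noncomputable def edgeWt (x : ℤ × ℤ → ℝ) (p q : ℤ × ℤ) : ℝ :=
  if q.2 = p.2 then (x p)⁻¹ else 1

/-- The weight of a directed path in `𝒢_R`, given as its list of vertices. -/
noncomputable def listWt (x : ℤ × ℤ → ℝ) (l : List (ℤ × ℤ)) : ℝ :=
  ((l.zip l.tail).map fun e => edgeWt x e.1 e.2).prod

/-- The boundary vertex `P_t` of `𝒢_R`: `P_j = (1,j)` for `1 ≤ j ≤ s`, `P_{s+i} = (i+1,s)`. -/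
def Pvert (s : ℕ) (t : ℤ) : ℤ × ℤ := if t ≤ (s : ℤ) then (1, t) else (t - s + 1, (s : ℤ))

/-- The boundary vertex `Q_t` of `𝒢_R`: `Q_i = (i,1)` for `1 ≤ i ≤ r`, `Q_{r+j} = (r+1,j)`. -/
def Qvert (r : ℕ) (t : ℤ) : ℤ × ℤ := if t ≤ (r : ℤ) then (t, 1) else ((r : ℤ) + 1, t - r)

/-- A collection of `k` pairwise vertex-disjoint directed paths in `𝒢_R` from
`{P_i, …, P_{i+k-1}}` to `{Q_j, …, Q_{j+k-1}}`. -/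
structure GSys (r s : ℕ) (i j : ℤ) (k : ℕ) where
  perm : Equiv.Perm (Fin k)
  path : Fin k → List (ℤ × ℤ)
  chain : ∀ t, (path t).Chain' (GEdge r s)
  first : ∀ t : Fin k, (path t).head? = some (Pvert s (i + ((t : ℕ) : ℤ)))
  final : ∀ t : Fin k, (path t).getLast? = some (Qvert r (j + (((perm t) : ℕ) : ℤ)))
  disjoint : ∀ t t' : Fin k, t ≠ t' → ∀ v ∈ path t, v ∉ path t'

/-- The weight of a collection of paths in `𝒢_R`: the product of the weights of all
edges used. -/
noncomputable def GSysWeight (x : ℤ × ℤ → ℝ) {r s : ℕ} {i j : ℤ} {k : ℕ}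
    (L : GSys r s i j k) : ℝ :=
  ∏ t : Fin k, listWt x (L.path t)

/-- `W_{ij}^{(k)}(x)`: total weight of all collections of `k` nonintersecting paths in
`𝒢_R` from `{P_i,…,P_{i+k-1}}` to `{Q_j,…,Q_{j+k-1}}`; `W_{ij}^{(0)} = 1`, and `0` when an
out-of-range index occurs. -/
noncomputable def W (r s : ℕ) (x : ℤ × ℤ → ℝ) (i j k : ℤ) : ℝ :=
  if k < 0 then 0
  else if k = 0 then 1
  else if 1 ≤ i ∧ 1 ≤ j ∧ i + k - 1 ≤ (r : ℤ) + s ∧ j + k - 1 ≤ (r : ℤ) + s then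
    ∑ᶠ L : GSys r s i j k.toNat, GSysWeight x L
  else 0


/-- `ρ_{[1,a]×[1,b]}⁻¹`: the inverse of the composition of the toggles of `R = [r] × [s]`
at the elements of the interval `[1,a] × [1,b]` (toggles applied from bottom to top). -/
noncomputable def rhoIInv (r s a b : ℕ) (x : ℤ × ℤ → ℝ) : ℤ × ℤ → ℝ :=
  (rectList a b).reverse.foldl (fun y p => toggle r s p y) x

/-- Auxiliary iterate: `RSKaux r s t = ρ_{[r-t]×[s-t]}⁻¹ ∘ ⋯ ∘ ρ_{[r-1]×[s-1]}⁻¹`. -/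
noncomputable def RSKaux (r s : ℕ) : ℕ → (ℤ × ℤ → ℝ) → (ℤ × ℤ → ℝ)
  | 0 => fun x => x
  | t + 1 => fun x => rhoIInv r s (r - (t + 1)) (s - (t + 1)) (RSKaux r s t x)

/-- The birational RSK map on labelings of `R = [r] × [s]`: with `m = min{r,s} - 1`,
`RSK = ρ_{[r-m]×[s-m]}⁻¹ ∘ ⋯ ∘ ρ_{[r-2]×[s-2]}⁻¹ ∘ ρ_{[r-1]×[s-1]}⁻¹ ∘ φ⁻¹`. -/
noncomputable def RSK (r s : ℕ) (x : ℤ × ℤ → ℝ) : ℤ × ℤ → ℝ :=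
  RSKaux r s (min r s - 1) (phiInv x)

/-- The lattice paths from `p` to `q`, as lists of successive cover steps. -/
def pathSet (p q : ℤ × ℤ) : Set (List (ℤ × ℤ)) :=
  {l | l.IsChain CoverStep ∧ l.head? = some p ∧ l.getLast? = some q}

/-- The lower neighbour of `q` in the first coordinate. -/
abbrev up (q : ℤ × ℤ) : ℤ × ℤ := (q.1 - 1, q.2)

/-- The lower neighbour of `q` in the second coordinate. -/
abbrev left (q : ℤ × ℤ) : ℤ × ℤ := (q.1, q.2 - 1)

lemma coverStep_iff {p q : ℤ × ℤ} : CoverStep p q ↔ p = up q ∨ p = left q := by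
  simp only [CoverStep, up, left, Prod.ext_iff]
  omega

lemma CoverStep.le {p q : ℤ × ℤ} (h : CoverStep p q) : p ≤ q := by
  simp only [CoverStep, Prod.le_def] at *
  omega

lemma mem_pathSet_le {p q v : ℤ × ℤ} {l : List (ℤ × ℤ)} (hl : l ∈ pathSet p q) (hv : v ∈ l) :
    p ≤ v ∧ v ≤ q := by
  obtain ⟨hc, hh, hf⟩ := hl
  have hp : l.Pairwise (· ≤ ·) := (hc.imp fun _ _ h => CoverStep.le h).pairwise
  constructor
  · obtain ⟨t, rfl⟩ : ∃ t, l = p :: t := by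
      cases l <;> simp_all
    rcases List.mem_cons.1 hv with rfl | hv
    · exact le_rfl
    · exact (List.pairwise_cons.1 hp).1 v hv
  · obtain ⟨t, rfl⟩ := List.getLast?_eq_some_iff.1 hf
    rcases List.mem_append.1 hv with hv | hv
    · exact (List.pairwise_append.1 hp).2.2 v hv q (by simp)
    · simp_all

lemma last_mem_of_mem_pathSet {p q : ℤ × ℤ} {l : List (ℤ × ℤ)} (hl : l ∈ pathSet p q) : q ∈ l :=
  List.mem_of_mem_getLast? hl.2.2

lemma pathSet_eq_empty {p q : ℤ × ℤ} (h : ¬ p ≤ q) : pathSet p q = ∅ :=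
  Set.eq_empty_of_forall_notMem fun _ hl => h (mem_pathSet_le hl (last_mem_of_mem_pathSet hl)).1

lemma append_mem_pathSet {p q q' : ℤ × ℤ} {l : List (ℤ × ℤ)} (hl : l ∈ pathSet p q')
    (h : CoverStep q' q) : l ++ [q] ∈ pathSet p q := by
  obtain ⟨hc, hh, hf⟩ := hl
  refine ⟨List.isChain_append.2 ⟨hc, List.isChain_singleton q, ?_⟩, ?_, by simp⟩
  · simp_all
  · simp [hh]

lemma exists_append_of_mem_pathSet {p q : ℤ × ℤ} {l : List (ℤ × ℤ)} (hl : l ∈ pathSet p q)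
    (h : q ≠ p) : ∃ l', l = l' ++ [q] ∧ (l' ∈ pathSet p (up q) ∨ l' ∈ pathSet p (left q)) := by
  obtain ⟨hc, hh, hf⟩ := hl
  obtain ⟨l', rfl⟩ := List.getLast?_eq_some_iff.1 hf
  refine ⟨l', rfl, ?_⟩
  rcases List.eq_nil_or_concat l' with rfl | ⟨m, q', rfl⟩
  · simp_all
  · have h1 := List.isChain_append.1 hc
    have h2 : CoverStep q' q := h1.2.2 q' (by simp) q (by simp)
    have h3 : m.concat q' ∈ pathSet p q' := by
      refine ⟨h1.1, ?_, by simp⟩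
      cases m <;> simp_all
    rcases coverStep_iff.1 h2 with rfl | rfl
    · exact Or.inl h3
    · exact Or.inr h3

lemma pathSet_self (p : ℤ × ℤ) : pathSet p p = {[p]} := by
  ext l
  constructor
  · intro hl
    obtain ⟨l', rfl⟩ := List.getLast?_eq_some_iff.1 hl.2.2
    rcases List.eq_nil_or_concat l' with rfl | ⟨m, q', rfl⟩
    · simp
    · have h1 := List.isChain_append.1 hl.1
      have h2 : CoverStep q' p := h1.2.2 q' (by simp) p (by simp)
      have h3 := (mem_pathSet_le hl (v := q') (by simp)).1
      simp only [CoverStep, Prod.le_def] at h2 h3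
      omega
  · rintro rfl
    exact ⟨List.isChain_singleton p, by simp, by simp⟩

lemma up_ne_left (q : ℤ × ℤ) : up q ≠ left q := by
  simp [up, left, Prod.ext_iff]

lemma pathSet_eq_union {p q : ℤ × ℤ} (h : q ≠ p) :
    pathSet p q = (· ++ [q]) '' pathSet p (up q) ∪ (· ++ [q]) '' pathSet p (left q) := by
  ext l
  constructor
  · intro hl
    obtain ⟨l', rfl, h' | h'⟩ := exists_append_of_mem_pathSet hl h
    · exact Or.inl ⟨l', h', rfl⟩
    · exact Or.inr ⟨l', h', rfl⟩
  · rintro (⟨l', h', rfl⟩ | ⟨l', h', rfl⟩)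
    · exact append_mem_pathSet h' (coverStep_iff.2 (Or.inl rfl))
    · exact append_mem_pathSet h' (coverStep_iff.2 (Or.inr rfl))

lemma pathSet_finite (p q : ℤ × ℤ) : (pathSet p q).Finite := by
  obtain ⟨n, hn⟩ : ∃ n : ℕ, (q.1 - p.1) + (q.2 - p.2) < n :=
    ⟨((q.1 - p.1) + (q.2 - p.2) + 1).toNat, by omega⟩
  induction n generalizing q with
  | zero =>
    rw [pathSet_eq_empty]
    · exact Set.finite_empty
    · simp only [Prod.le_def]
      omega
  | succ n ih =>
    by_cases h : q = p
    · rw [h, pathSet_self]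
      exact Set.finite_singleton _
    · rw [pathSet_eq_union h]
      refine ((ih _ ?_).image _).union ((ih _ ?_).image _) <;>
      · push_cast at hn
        dsimp only
        omega

/-- The total weight of all lattice paths from `p` to `q`. -/
noncomputable def pathSum (x : ℤ × ℤ → ℝ) (p q : ℤ × ℤ) : ℝ :=
  ∑ᶠ l ∈ pathSet p q, (l.map x).prod

lemma pathSum_self (x : ℤ × ℤ → ℝ) (p : ℤ × ℤ) : pathSum x p p = x p := by
  simp [pathSum, pathSet_self]

lemma pathSum_eq_zero (x : ℤ × ℤ → ℝ) {p q : ℤ × ℤ} (h : ¬ p ≤ q) : pathSum x p q = 0 := by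
  simp [pathSum, pathSet_eq_empty h]

lemma pathSum_step (x : ℤ × ℤ → ℝ) {p q : ℤ × ℤ} (h : q ≠ p) :
    pathSum x p q = x q * (pathSum x p (up q) + pathSum x p (left q)) := by
  have hinj : ∀ s : Set (List (ℤ × ℤ)), Set.InjOn (· ++ [q]) s := fun s =>
    (List.append_left_injective [q]).injOn
  unfold pathSum
  rw [pathSet_eq_union h, finsum_mem_union, finsum_mem_image (hinj _), finsum_mem_image (hinj _),
    mul_add, mul_finsum_mem, mul_finsum_mem]
  · simp [mul_comm]
  · rw [Set.disjoint_left]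
    rintro _ ⟨l, hl, rfl⟩ ⟨l', hl', h'⟩
    have h' := List.append_left_injective [q] h'
    subst h'
    have := hl.2.2.symm.trans hl'.2.2
    exact up_ne_left q (Option.some.inj this)
  · exact (pathSet_finite _ _).image _
  · exact (pathSet_finite _ _).image _

/-- Families of pairwise vertex-disjoint lattice paths from `p t` to `e t`. -/
def disjPaths {ι : Type*} (p e : ι → ℤ × ℤ) : Set (ι → List (ℤ × ℤ)) :=
  {L | (∀ t, L t ∈ pathSet (p t) (e t)) ∧ ∀ t t', t ≠ t' → ∀ v ∈ L t, v ∉ L t'}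

/-- The total weight of all families of pairwise vertex-disjoint lattice paths. -/
noncomputable def disjPathSum {ι : Type*} [Fintype ι] (x : ℤ × ℤ → ℝ) (p e : ι → ℤ × ℤ) : ℝ :=
  ∑ᶠ L ∈ disjPaths p e, ∏ t, ((L t).map x).prod

lemma disjPaths_eq_empty {ι : Type*} {p e : ι → ℤ × ℤ} {t : ι} (h : ¬ p t ≤ e t) :
    disjPaths p e = ∅ :=
  Set.eq_empty_of_forall_notMem fun L hL => by
    have := hL.1 t
    rw [pathSet_eq_empty h] at this
    exact this

lemma disjPaths_eq_empty_of_eq {ι : Type*} {p e : ι → ℤ × ℤ} {t t' : ι} (hne : t ≠ t')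
    (h : e t = e t') : disjPaths p e = ∅ :=
  Set.eq_empty_of_forall_notMem fun _ hL =>
    hL.2 t t' hne _ (last_mem_of_mem_pathSet (hL.1 t))
      (h ▸ last_mem_of_mem_pathSet (hL.1 t'))

lemma disjPathSum_eq_zero {ι : Type*} [Fintype ι] {p e : ι → ℤ × ℤ} (x : ℤ × ℤ → ℝ)
    (h : disjPaths p e = ∅) : disjPathSum x p e = 0 := by
  simp [disjPathSum, h]

section Families

variable {ι : Type*} [DecidableEq ι] {p e : ι → ℤ × ℤ}

/-- Append a vertex to the path with index `t`. -/
def appendAt (t : ι) (q : ℤ × ℤ) (L : ι → List (ℤ × ℤ)) : ι → List (ℤ × ℤ) :=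
  Function.update L t (L t ++ [q])

lemma appendAt_injective (t : ι) (q : ℤ × ℤ) : Function.Injective (appendAt t q) := by
  intro L L' h
  funext t'
  have h' := congrFun h t'
  by_cases htt : t' = t
  · subst htt
    simpa [appendAt] using h'
  · simpa [appendAt, htt] using h'

lemma appendAt_mem_disjPaths {t : ι} (hmax : ∀ t', t' ≠ t → ¬ e t ≤ e t') {q : ℤ × ℤ}
    (hq : CoverStep q (e t)) {L : ι → List (ℤ × ℤ)}
    (hL : L ∈ disjPaths p (Function.update e t q)) : appendAt t (e t) L ∈ disjPaths p e := by
  obtain ⟨h1, h2⟩ := hL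
  have hnot : ∀ t', t' ≠ t → e t ∉ L t' := fun t' ht' hv =>
    hmax t' ht' (by simpa [ht'] using (mem_pathSet_le (h1 t') hv).2)
  refine ⟨fun t' => ?_, fun a b hab v hv hv' => ?_⟩
  · by_cases ht : t' = t
    · subst ht
      simpa [appendAt] using append_mem_pathSet (by simpa using h1 t') hq
    · simpa [appendAt, ht] using h1 t'
  · by_cases ha : a = t
    · subst ha
      have hb : b ≠ a := hab.symm
      simp only [appendAt, Function.update_self, Function.update_of_ne hb, List.mem_append,
        List.mem_singleton] at hv hv'
      rcases hv with hv | rfl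
      · exact h2 a b hab v hv hv'
      · exact hnot b hb hv'
    · by_cases hb : b = t
      · subst hb
        simp only [appendAt, Function.update_self, Function.update_of_ne ha, List.mem_append,
          List.mem_singleton] at hv hv'
        rcases hv' with hv' | rfl
        · exact h2 a b hab v hv hv'
        · exact hnot a ha hv
      · simp only [appendAt, Function.update_of_ne ha, Function.update_of_ne hb] at hv hv'
        exact h2 a b hab v hv hv'

lemma disjPaths_eq_union {t : ι} (hne : e t ≠ p t) (hmax : ∀ t', t' ≠ t → ¬ e t ≤ e t') :
    disjPaths p e = appendAt t (e t) '' disjPaths p (Function.update e t (up (e t))) ∪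
      appendAt t (e t) '' disjPaths p (Function.update e t (left (e t))) := by
  ext L
  constructor
  · rintro ⟨h1, h2⟩
    obtain ⟨l, hl, hl'⟩ := exists_append_of_mem_pathSet (h1 t) hne
    have hL : appendAt t (e t) (Function.update L t l) = L := by
      funext t'
      by_cases ht : t' = t
      · subst ht
        simp [appendAt, hl]
      · simp [appendAt, ht]
    have hmem : ∀ q, l ∈ pathSet (p t) q →
        Function.update L t l ∈ disjPaths p (Function.update e t q) := by
      have hsub : ∀ a, ∀ v ∈ Function.update L t l a, v ∈ L a := by
        intro a v hv
        by_cases ha : a = t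
        · subst ha
          rw [hl]
          simp at hv ⊢
          exact Or.inl hv
        · simpa [ha] using hv
      refine fun q hq => ⟨fun t' => ?_, fun a b hab v hv hv' =>
        h2 a b hab v (hsub a v hv) (hsub b v hv')⟩
      by_cases ht : t' = t
      · subst ht
        simpa using hq
      · simpa [ht] using h1 t'
    rcases hl' with hl' | hl'
    · exact Or.inl ⟨_, hmem _ hl', hL⟩
    · exact Or.inr ⟨_, hmem _ hl', hL⟩
  · rintro (⟨L, hL, rfl⟩ | ⟨L, hL, rfl⟩)
    · exact appendAt_mem_disjPaths hmax (coverStep_iff.2 (Or.inl rfl)) hL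
    · exact appendAt_mem_disjPaths hmax (coverStep_iff.2 (Or.inr rfl)) hL

variable [Fintype ι]

lemma prod_appendAt (x : ℤ × ℤ → ℝ) (t : ι) (q : ℤ × ℤ) (L : ι → List (ℤ × ℤ)) :
    ∏ t', ((appendAt t q L t').map x).prod = x q * ∏ t', ((L t').map x).prod := by
  rw [← Finset.mul_prod_erase _ _ (Finset.mem_univ t),
    ← Finset.mul_prod_erase _ (fun t' => ((L t').map x).prod) (Finset.mem_univ t),
    Finset.prod_congr rfl (g := fun t' => ((L t').map x).prod)]
  · simp [appendAt]
    ring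
  · intro t' ht'
    simp [appendAt, Finset.ne_of_mem_erase ht']

lemma disjPathSum_step (x : ℤ × ℤ → ℝ) {t : ι} (hne : e t ≠ p t)
    (hmax : ∀ t', t' ≠ t → ¬ e t ≤ e t')
    (hu : (disjPaths p (Function.update e t (up (e t)))).Finite)
    (hl : (disjPaths p (Function.update e t (left (e t)))).Finite) :
    disjPathSum x p e = x (e t) * (disjPathSum x p (Function.update e t (up (e t))) +
      disjPathSum x p (Function.update e t (left (e t)))) := by
  unfold disjPathSum
  rw [disjPaths_eq_union hne hmax, finsum_mem_union,
    finsum_mem_image (appendAt_injective t (e t)).injOn,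
    finsum_mem_image (appendAt_injective t (e t)).injOn, mul_add, mul_finsum_mem, mul_finsum_mem]
  · simp only [prod_appendAt]
  · rw [Set.disjoint_left]
    rintro _ ⟨L, hL, rfl⟩ ⟨L', hL', h'⟩
    have h' := appendAt_injective t (e t) h'
    subst h'
    have := (hL.1 t).2.2.symm.trans (hL'.1 t).2.2
    simp only [Function.update_self] at this
    exact up_ne_left _ (Option.some.inj this)
  · exact hu.image _
  · exact hl.image _

end Families

lemma StrictMono.add_sub_le {n : ℕ} {f : Fin n → ℤ} (hf : StrictMono f) {a b : Fin n}
    (hab : a ≤ b) : f a + ((b : ℕ) - (a : ℕ) : ℤ) ≤ f b := by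
  obtain ⟨d, hd⟩ := Nat.exists_eq_add_of_le (Fin.le_def.1 hab)
  induction d generalizing b with
  | zero =>
    obtain rfl : b = a := Fin.ext hd
    simp
  | succ d ih =>
    have hlt : (a : ℕ) + d < n := by omega
    have h1 := ih (b := ⟨a + d, hlt⟩) (Fin.le_def.2 (by simp)) rfl
    have h2 := hf (show (⟨a + d, hlt⟩ : Fin n) < b from Fin.lt_def.2 (by simp; omega))
    simp only at h1
    push_cast at h1
    omega

/-- The matrix of path sums between two families of points. -/
noncomputable def pathMatrix {k : ℕ} (x : ℤ × ℤ → ℝ) (p e : Fin k → ℤ × ℤ) :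
    Matrix (Fin k) (Fin k) ℝ :=
  Matrix.of fun a b => pathSum x (p a) (e b)

lemma pathMatrix_update {k : ℕ} (x : ℤ × ℤ → ℝ) (p e : Fin k → ℤ × ℤ) (t : Fin k) (q : ℤ × ℤ) :
    pathMatrix x p (Function.update e t q) =
      (pathMatrix x p e).updateCol t fun a => pathSum x (p a) q := by
  ext a b
  by_cases hb : b = t
  · subst hb
    simp [pathMatrix]
  · simp [pathMatrix, hb]

lemma det_pathMatrix_step {k : ℕ} (x : ℤ × ℤ → ℝ) (p e : Fin k → ℤ × ℤ) (t : Fin k)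
    (h : ∀ a, e t ≠ p a) :
    (pathMatrix x p e).det = x (e t) * ((pathMatrix x p (Function.update e t (up (e t)))).det +
      (pathMatrix x p (Function.update e t (left (e t)))).det) := by
  rw [pathMatrix_update, pathMatrix_update, ← Matrix.det_updateCol_add,
    ← Matrix.det_updateCol_smul]
  congr 1
  ext a b
  by_cases hb : b = t
  · subst hb
    simp [pathMatrix, pathSum_step x (h a), mul_add]
  · simp [hb]

lemma det_pathMatrix_eq_zero {k : ℕ} (x : ℤ × ℤ → ℝ) (p e : Fin k → ℤ × ℤ) (t : Fin k)
    (h : ∀ a, ¬ p a ≤ e t) : (pathMatrix x p e).det = 0 :=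
  Matrix.det_eq_zero_of_column_eq_zero t fun a => by
    simp [pathMatrix, pathSum_eq_zero x (h a)]

/-- `k` consecutive points in row `i`, beginning at column `j`. -/
def rowPoints (k : ℕ) (i j : ℤ) (t : Fin k) : ℤ × ℤ := (i, j + ((t : ℕ) : ℤ))

lemma rowPoints_injective (k : ℕ) (i j : ℤ) : Function.Injective (rowPoints k i j) := by
  intro a b h
  simp only [rowPoints, Prod.mk.injEq, true_and] at h
  exact Fin.ext (by omega)

lemma lgv_base {k : ℕ} (x : ℤ × ℤ → ℝ) (i j : ℤ) (e : Fin k → ℤ × ℤ)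
    (hrow : ∀ t, (e t).1 = i) (hcol : ∀ t, (e t).2 ≤ j + ((t : ℕ) : ℤ)) :
    (disjPaths (rowPoints k i j) e).Finite ∧
      disjPathSum x (rowPoints k i j) e = (pathMatrix x (rowPoints k i j) e).det := by
  have hdet : (pathMatrix x (rowPoints k i j) e).det =
      ∏ t, pathSum x (rowPoints k i j t) (e t) := by
    rw [Matrix.det_of_isUpperTriangular]
    · rfl
    · intro a b hab
      refine pathSum_eq_zero x fun hle => ?_
      have h1 := hcol b
      have h2 := (Prod.le_def.1 hle).2
      have h3 : b < a := hab
      rw [Fin.lt_def] at h3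
      simp only [rowPoints] at h2
      omega
  by_cases h : ∀ t, e t = rowPoints k i j t
  · obtain rfl : e = rowPoints k i j := funext h
    have hset : disjPaths (rowPoints k i j) (rowPoints k i j) =
        {fun t => [rowPoints k i j t]} := by
      ext L
      constructor
      · intro hL
        funext t
        have := hL.1 t
        rwa [pathSet_self] at this
      · rintro rfl
        refine ⟨fun t => by rw [pathSet_self]; rfl, fun t t' hne v hv hv' => hne ?_⟩
        rw [List.mem_singleton] at hv hv'
        exact rowPoints_injective k i j (hv.symm.trans hv')
    rw [hdet, hset]
    refine ⟨Set.finite_singleton _, ?_⟩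
    simp [disjPathSum, hset, pathSum_self]
  · push Not at h
    obtain ⟨t, ht⟩ := h
    have hnot : ¬ rowPoints k i j t ≤ e t := by
      intro hle
      apply ht
      have h1 := hcol t
      have h2 := (Prod.le_def.1 hle).2
      have h3 := hrow t
      simp only [rowPoints] at h2 ⊢
      exact Prod.ext h3 (by simp only; omega)
    rw [disjPathSum_eq_zero x (disjPaths_eq_empty hnot), disjPaths_eq_empty hnot, hdet]
    refine ⟨Set.finite_empty, (Finset.prod_eq_zero (Finset.mem_univ t) ?_).symm⟩
    exact pathSum_eq_zero x hnot

lemma exists_last_eq {k : ℕ} (f : Fin (k + 1) → ℤ) (hf : Antitone f) :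
    ∃ t, (∀ t' ≤ t, f t' = f t) ∧ ∀ t', t < t' → f t' < f t := by
  obtain ⟨t, ht, hmax⟩ := (Finset.univ.filter fun t => f t = f 0).exists_max_image id
    ⟨0, by simp⟩
  simp only [Finset.mem_filter, Finset.mem_univ, true_and, id] at ht hmax
  refine ⟨t, fun t' h => le_antisymm ?_ (hf h), fun t' h => lt_of_le_of_ne (hf h.le) fun heq => ?_⟩
  · rw [ht]
    exact hf (Fin.zero_le t')
  · exact absurd (hmax t' (heq.trans ht)) (not_le.2 h)

lemma sum_update_sub_one {k : ℕ} (f g : Fin k → ℤ) (t : Fin k) (ht : g t = f t - 1)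
    (h : ∀ t', t' ≠ t → g t' = f t') : ∑ t', g t' = ∑ t', f t' - 1 := by
  rw [← Finset.add_sum_erase _ f (Finset.mem_univ t),
    ← Finset.add_sum_erase _ g (Finset.mem_univ t), ht,
    Finset.sum_congr rfl fun t' ht' => h t' (Finset.ne_of_mem_erase ht')]
  ring

/-- The Lindström–Gessel–Viennot formula for paths which start at consecutive points of a row and
end at points with increasing columns and weakly decreasing rows. -/
theorem disjPathSum_eq_det {k : ℕ} (x : ℤ × ℤ → ℝ) (i j : ℤ) (e : Fin (k + 1) → ℤ × ℤ)
    (hcol : StrictMono fun t => (e t).2) (hrow : Antitone fun t => (e t).1)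
    (hi : ∀ t, i ≤ (e t).1) :
    (disjPaths (rowPoints (k + 1) i j) e).Finite ∧
      disjPathSum x (rowPoints (k + 1) i j) e = (pathMatrix x (rowPoints (k + 1) i j) e).det := by
  set p := rowPoints (k + 1) i j with hp
  have hzero : ∀ (e : Fin (k + 1) → ℤ × ℤ) (t : Fin (k + 1)), (∀ a, ¬ p a ≤ e t) →
      (disjPaths p e).Finite ∧ disjPathSum x p e = (pathMatrix x p e).det := by
    intro e t h
    rw [disjPathSum_eq_zero x (disjPaths_eq_empty (h t)), disjPaths_eq_empty (h t),
      det_pathMatrix_eq_zero x p e t h]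
    exact ⟨Set.finite_empty, rfl⟩
  obtain ⟨n, hn⟩ : ∃ n : ℕ, ∑ t, ((e t).1 + (e t).2 - i - j) < n :=
    ⟨(∑ t, ((e t).1 + (e t).2 - i - j) + 1).toNat, by omega⟩
  induction n generalizing e with
  | zero =>
    obtain ⟨t, -, ht⟩ := Finset.exists_lt_of_sum_lt
      (s := Finset.univ) (f := fun t => (e t).1 + (e t).2 - i - j) (g := fun _ => 0) (by simpa using hn)
    refine hzero e t fun a hle => ?_
    have h1 := hi t
    have h2 := (Prod.le_def.1 hle).2
    simp only [hp, rowPoints] at h2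
    omega
  | succ n ih =>
    obtain ⟨t, hle, hlt⟩ := exists_last_eq _ hrow
    by_cases hbase : (e t).1 = i ∧ (e t).2 ≤ j + ((t : ℕ) : ℤ)
    · have hlast : ∀ t', t' ≤ t := fun t' => not_lt.1 fun h => by
        have := hlt t' h
        have := hi t'
        omega
      refine lgv_base x i j e (fun t' => (hle t' (hlast t')).trans hbase.1) fun t' => ?_
      have := StrictMono.add_sub_le hcol (hlast t')
      omega
    · have hne : ∀ a, e t ≠ p a := by
        intro a ha
        have h1 : (e t).1 = i := by rw [ha]; rfl
        have h2 : (e t).2 = j + ((a : ℕ) : ℤ) := by rw [ha]; rfl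
        have h3 : t < a := by
          rw [Fin.lt_def]
          omega
        have := hlt a h3
        have := hi a
        omega
      have hmax : ∀ t', t' ≠ t → ¬ e t ≤ e t' := by
        intro t' ht' h
        rw [Prod.le_def] at h
        rcases lt_or_gt_of_ne ht' with h' | h'
        · have := hcol h'
          simp only at this
          omega
        · have := hlt t' h'
          omega
      have hup : (disjPaths p (Function.update e t (up (e t)))).Finite ∧
          disjPathSum x p (Function.update e t (up (e t))) =
            (pathMatrix x p (Function.update e t (up (e t)))).det := by
        by_cases hti : (e t).1 = i
        · refine hzero _ t fun a h => ?_
          have := (Prod.le_def.1 h).1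
          simp only [hp, rowPoints, Function.update_self, up] at this
          omega
        · have hti' : i < (e t).1 := lt_of_le_of_ne (hi t) (Ne.symm hti)
          have hc : ∀ t', (Function.update e t (up (e t)) t').2 = (e t').2 := by
            intro t'
            by_cases h : t' = t
            · subst h; simp
            · simp [h]
          have hr : ∀ t', t' ≠ t → (Function.update e t (up (e t)) t').1 = (e t').1 := by
            intro t' h
            simp [h]
          have hrt : (Function.update e t (up (e t)) t).1 = (e t).1 - 1 := by simp
          refine ih _ ?_ ?_ ?_ ?_
          · simpa only [hc] using hcol
          · intro a b hab
            have h0 := hrow hab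
            simp only at h0 ⊢
            by_cases ha : a = t
            · subst ha
              by_cases hb : b = a
              · subst hb; exact le_rfl
              · have := hlt b (lt_of_le_of_ne hab (Ne.symm hb))
                rw [hrt, hr b hb]
                omega
            · rw [hr a ha]
              by_cases hb : b = t
              · subst hb
                rw [hrt]
                omega
              · rwa [hr b hb]
          · intro t'
            by_cases h : t' = t
            · subst h
              rw [hrt]
              omega
            · rw [hr t' h]
              exact hi t'
          · rw [sum_update_sub_one (fun t => (e t).1 + (e t).2 - i - j) _ t]
            · push_cast at hn
              omega
            · rw [hrt, hc]
              ring
            · intro t' h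
              rw [hr t' h, hc]
      have hleft : (disjPaths p (Function.update e t (left (e t)))).Finite ∧
          disjPathSum x p (Function.update e t (left (e t))) =
            (pathMatrix x p (Function.update e t (left (e t)))).det := by
        by_cases hex : ∃ t', t' ≠ t ∧ e t' = left (e t)
        · obtain ⟨t', ht', hc⟩ := hex
          have heq : Function.update e t (left (e t)) t' = Function.update e t (left (e t)) t := by
            simp [ht', hc]
          have hemp : disjPaths p (Function.update e t (left (e t))) = ∅ :=
            disjPaths_eq_empty_of_eq ht' heq
          rw [disjPathSum_eq_zero x hemp, hemp]
          refine ⟨Set.finite_empty, (Matrix.det_zero_of_column_eq ht' fun a => ?_).symm⟩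
          simp only [pathMatrix, Matrix.of_apply, heq]
        · push Not at hex
          have hr : ∀ t', (Function.update e t (left (e t)) t').1 = (e t').1 := by
            intro t'
            by_cases h : t' = t
            · subst h; simp
            · simp [h]
          have hc : ∀ t', t' ≠ t → (Function.update e t (left (e t)) t').2 = (e t').2 := by
            intro t' h
            simp [h]
          have hct : (Function.update e t (left (e t)) t).2 = (e t).2 - 1 := by simp
          refine ih _ ?_ ?_ ?_ ?_
          · intro a b hab
            have h0 := hcol hab
            simp only at h0 ⊢
            by_cases ha : a = t
            · subst ha
              rw [hct, hc b hab.ne']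
              omega
            · rw [hc a ha]
              by_cases hb : b = t
              · subst hb
                rw [hct]
                have h1 := hex a ha
                have h2 := hle a hab.le
                refine lt_of_le_of_ne (by omega) fun h3 => h1 (Prod.ext h2 h3)
              · rwa [hc b hb]
          · simpa only [hr] using hrow
          · simpa only [hr] using hi
          · rw [sum_update_sub_one (fun t => (e t).1 + (e t).2 - i - j) _ t]
            · push_cast at hn
              omega
            · rw [hct, hr]
              ring
            · intro t' h
              rw [hc t' h, hr]
      refine ⟨?_, ?_⟩
      · rw [disjPaths_eq_union (hne t) hmax]
        exact (hup.1.image _).union (hleft.1.image _)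
      · rw [disjPathSum_step x (hne t) hmax hup.1 hleft.1, hup.2, hleft.2,
          det_pathMatrix_step x p e t hne]

/-- The total weight of `k` nonintersecting paths in an interval as a determinant. -/
noncomputable def pathDet (x : ℤ × ℤ → ℝ) (i₁ j₁ i₂ j₂ : ℤ) (k : ℕ) : ℝ :=
  (pathMatrix x (rowPoints k i₁ j₁) (rowPoints k i₂ (j₂ - k + 1))).det

lemma w_eq_pathDet (x : ℤ × ℤ → ℝ) (i₁ j₁ i₂ j₂ : ℤ) (h : i₁ ≤ i₂) (k : ℕ) :
    w i₁ i₂ j₁ j₂ k x = pathDet x i₁ j₁ i₂ j₂ k := by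
  rcases k with _ | k
  · simp [w, pathDet]
  · have hk : ¬ (((k + 1 : ℕ) : ℤ) ≤ 0) := by omega
    rw [w, if_neg hk, pathDet, ← (disjPathSum_eq_det x i₁ j₁ _ _ _ _).2, disjPathSum,
      ← finsum_set_coe_eq_finsum_mem
        (f := fun L : Fin (k + 1) → List (ℤ × ℤ) => ∏ t, ((L t).map x).prod)]
    · refine finsum_eq_of_bijective (fun L => ⟨L.path, ?_, L.disjoint⟩) ⟨?_, ?_⟩ fun _ => rfl
      · exact fun t => ⟨L.chain t, L.first t, L.final t⟩
      · rintro ⟨L, _, _, _, _, _⟩ ⟨L', _, _, _, _, _⟩ heq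
        obtain rfl : L = L' := congrArg Subtype.val heq
        rfl
      · rintro ⟨L, hL⟩
        refine ⟨⟨L, fun t => (hL.1 t).1, fun t v hv => ?_, fun t => (hL.1 t).2.1,
          fun t => (hL.1 t).2.2, hL.2⟩, rfl⟩
        have h1 := mem_pathSet_le (hL.1 t) hv
        have ht : (t : ℕ) < k + 1 := t.2
        simp only [rowPoints, Prod.le_def] at h1
        push_cast at h1
        omega
    · intro a b hab
      have := Fin.lt_def.1 hab
      simp only [rowPoints]
      omega
    · intro a b _
      exact le_rfl
    · intro t
      exact h

lemma phiInv_eq_pathSum (x : ℤ × ℤ → ℝ) : phiInv x = pathSum x (1, 1) := by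
  funext p
  exact finsum_set_coe_eq_finsum_mem (pathSet (1, 1) p) (f := fun l => (l.map x).prod)

lemma pathSum_unique {x G : ℤ × ℤ → ℝ} {p B : ℤ × ℤ} (h0 : ∀ q ≤ B, ¬ p ≤ q → G q = 0)
    (h1 : p ≤ B → G p = x p)
    (h2 : ∀ q ≤ B, p ≤ q → q ≠ p → G q = x q * (G (up q) + G (left q))) {q : ℤ × ℤ}
    (hq : q ≤ B) : G q = pathSum x p q := by
  obtain ⟨n, hn⟩ : ∃ n : ℕ, (q.1 - p.1) + (q.2 - p.2) < n :=
    ⟨((q.1 - p.1) + (q.2 - p.2) + 1).toNat, by omega⟩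
  induction n generalizing q with
  | zero =>
    have : ¬ p ≤ q := by
      simp only [Prod.le_def]
      omega
    rw [h0 q hq this, pathSum_eq_zero x this]
  | succ n ih =>
    by_cases hpq : p ≤ q
    · by_cases h : q = p
      · subst h
        rw [h1 hq, pathSum_self]
      · rw [h2 q hq hpq h, pathSum_step x h]
        push_cast at hn
        rw [Prod.le_def] at hq
        rw [ih (q := up q), ih (q := left q)]
        all_goals first | (rw [Prod.le_def]; constructor <;> simp only <;> omega) | (simp only; omega)
    · rw [h0 q hq hpq, pathSum_eq_zero x hpq]

lemma pathSum_congr {x x' : ℤ × ℤ → ℝ} {p q : ℤ × ℤ}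
    (h : ∀ v, p ≤ v → v ≤ q → x v = x' v) : pathSum x p q = pathSum x' p q :=
  finsum_mem_congr rfl fun l hl => by
    rw [List.map_congr_left fun v hv => h v (mem_pathSet_le hl hv).1 (mem_pathSet_le hl hv).2]

lemma pathSum_translate (x : ℤ × ℤ → ℝ) (d p q : ℤ × ℤ) :
    pathSum (fun v => x (v + d)) p q = pathSum x (p + d) (q + d) := by
  refine (pathSum_unique (G := fun q => pathSum x (p + d) (q + d)) (B := q) ?_ ?_ ?_ le_rfl).symm
  · intro q _ h
    exact pathSum_eq_zero x (by simpa using h)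
  · intro _
    exact pathSum_self x _
  · intro q _ _ h
    rw [pathSum_step x (by simpa using h)]
    congr 3 <;> ext <;> simp [up, left] <;> ring

lemma pathSum_swap (x : ℤ × ℤ → ℝ) (p q : ℤ × ℤ) :
    pathSum (fun v => x v.swap) p q = pathSum x p.swap q.swap := by
  refine (pathSum_unique (G := fun q => pathSum x p.swap q.swap) (B := q) ?_ ?_ ?_ le_rfl).symm
  · intro q _ h
    exact pathSum_eq_zero x (by simpa using h)
  · intro _
    exact pathSum_self x _
  · intro q _ _ h
    rw [pathSum_step x (by simpa using h), add_comm]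
    rfl

lemma pathSum_nonneg {x : ℤ × ℤ → ℝ} {p q : ℤ × ℤ} (h : ∀ v, p ≤ v → v ≤ q → 0 ≤ x v) :
    0 ≤ pathSum x p q := by
  refine finsum_nonneg fun l => finsum_nonneg fun hl => List.prod_nonneg fun y hy => ?_
  obtain ⟨v, hv, rfl⟩ := List.mem_map.1 hy
  exact h v (mem_pathSet_le hl hv).1 (mem_pathSet_le hl hv).2

lemma pathSum_pos {x : ℤ × ℤ → ℝ} {p q : ℤ × ℤ} (hpq : p ≤ q)
    (h : ∀ v, p ≤ v → v ≤ q → 0 < x v) : 0 < pathSum x p q := by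
  obtain ⟨n, hn⟩ : ∃ n : ℕ, (q.1 - p.1) + (q.2 - p.2) < n :=
    ⟨((q.1 - p.1) + (q.2 - p.2) + 1).toNat, by omega⟩
  have hup : ∀ q, up q ≤ q := fun q => by simp [Prod.le_def]
  have hleft : ∀ q, left q ≤ q := fun q => by simp [Prod.le_def]
  induction n generalizing q with
  | zero =>
    rw [Prod.le_def] at hpq
    omega
  | succ n ih =>
    by_cases hq : q = p
    · subst hq
      rw [pathSum_self]
      exact h q le_rfl le_rfl
    · rw [pathSum_step x hq]
      push_cast at hn
      have h1 := pathSum_nonneg fun v hv hv' => (h v hv (le_trans hv' (hup q))).le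
      have h2 := pathSum_nonneg fun v hv hv' => (h v hv (le_trans hv' (hleft q))).le
      refine mul_pos (h q hpq le_rfl) ?_
      by_cases hu : p ≤ up q
      · refine add_pos_of_pos_of_nonneg
          (ih hu (fun v hv hv' => h v hv (le_trans hv' (hup q))) ?_) h2
        simp only
        omega
      · refine add_pos_of_nonneg_of_pos h1
          (ih ?_ (fun v hv hv' => h v hv (le_trans hv' (hleft q))) ?_)
        · simp only [Prod.le_def, Prod.ext_iff] at *
          omega
        · simp only
          omega

/-- The right-hand side of the recursion for path sums starting in row one at column `c`. -/
noncomputable def gridRec (c : ℤ) (z : ℤ × ℤ → ℝ) (G : ℤ → ℤ → ℝ) (i j : ℤ) : ℝ :=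
  z (i, j) * ((if i = 1 then (if j = c then 1 else 0) else G (i - 1) j) +
    (if j = 1 then 0 else G i (j - 1)))

lemma pathSum_gridRec {c : ℤ} (hc : 1 ≤ c) (z : ℤ × ℤ → ℝ) {i j : ℤ} (hi : 1 ≤ i) :
    pathSum z (1, c) (i, j) = gridRec c z (fun i j => pathSum z (1, c) (i, j)) i j := by
  have hleft : (if j = 1 then 0 else pathSum z (1, c) (i, j - 1)) = pathSum z (1, c) (i, j - 1) := by
    split_ifs with h
    · rw [pathSum_eq_zero]
      simp only [Prod.mk_le_mk]
      omega
    · rfl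
  simp only [gridRec, hleft]
  by_cases h : (i, j) = (1, c)
  · simp only [Prod.mk.injEq] at h
    obtain ⟨rfl, rfl⟩ := h
    rw [pathSum_self, pathSum_eq_zero (q := (1, j - 1))]
    · simp
    · simp
  · rw [pathSum_step z h]
    simp only [up, left]
    congr 2
    split_ifs with h1 h2
    · exact absurd (by rw [h1, h2]) h
    · rw [pathSum_eq_zero]
      simp only [Prod.mk_le_mk]
      omega
    · rfl

lemma gridRec_unique {c a b : ℤ} (hc : 1 ≤ c) {z : ℤ × ℤ → ℝ} {G : ℤ → ℤ → ℝ}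
    (hG : ∀ i j, 1 ≤ i → i ≤ a → 1 ≤ j → j ≤ b → G i j = gridRec c z G i j)
    {i j : ℤ} (hi : 1 ≤ i) (hia : i ≤ a) (hj : 1 ≤ j) (hjb : j ≤ b) :
    G i j = pathSum z (1, c) (i, j) := by
  obtain ⟨n, hn⟩ : ∃ n : ℕ, i + j < n := ⟨(i + j + 1).toNat, by omega⟩
  induction n generalizing i j with
  | zero => omega
  | succ n ih =>
    rw [hG i j hi hia hj hjb, pathSum_gridRec hc z hi, gridRec, gridRec]
    push_cast at hn
    congr 2
    · split_ifs
      · rfl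
      · rfl
      · exact ih (by omega) (by omega) hj hjb (by omega)
    · split_ifs
      · rfl
      · exact ih hi hia (by omega) (by omega) (by omega)

/-- The labels of the interior of a rectangle after one step of inverse rowmotion. -/
noncomputable def darboux (x : ℤ × ℤ → ℝ) (q : ℤ × ℤ) : ℝ :=
  ((pathSum x (1, 1) (q.1 + 1, q.2))⁻¹ + (pathSum x (1, 1) (q.1, q.2 + 1))⁻¹)⁻¹ /
    pathSum x (1, 1) q

/-- The Casoratian-type quotient which transforms path sums under `darboux`. -/
noncomputable def casorati (x : ℤ × ℤ → ℝ) (c i j : ℤ) : ℝ :=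
  pathSum x (1, c + 1) (i, j + 1) * pathSum x (1, 1) (i, j) / pathSum x (1, 1) (i, j + 1) -
    pathSum x (1, c + 1) (i, j)

/-- Positivity of a labeling on `[1,a] × [1,b]`. -/
def PosOn (a b : ℤ) (x : ℤ × ℤ → ℝ) : Prop :=
  ∀ i j, 1 ≤ i → i ≤ a → 1 ≤ j → j ≤ b → 0 < x (i, j)

lemma PosOn.mono {a b a' b' : ℤ} {x : ℤ × ℤ → ℝ} (h : PosOn a b x) (ha : a' ≤ a) (hb : b' ≤ b) :
    PosOn a' b' x :=
  fun i j hi hi' hj hj' => h i j hi (hi'.trans ha) hj (hj'.trans hb)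

lemma PosOn.pathSum {a b : ℤ} {x : ℤ × ℤ → ℝ} (hx : PosOn a b x) :
    PosOn a b (pathSum x (1, 1)) := by
  intro i j hi hia hj hjb
  refine pathSum_pos (Prod.mk_le_mk.2 ⟨hi, hj⟩) fun v hv hv' => ?_
  rw [Prod.le_def] at hv hv'
  exact hx v.1 v.2 hv.1 (hv'.1.trans hia) hv.2 (hv'.2.trans hjb)

lemma PosOn.darboux {a b : ℤ} {x : ℤ × ℤ → ℝ} (hx : PosOn a b x) :
    PosOn (a - 1) (b - 1) (darboux x) := by
  intro i j hi hia hj hjb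
  have h1 := hx.pathSum (i + 1) j (by omega) (by omega) hj (by omega)
  have h2 := hx.pathSum i (j + 1) hi (by omega) (by omega) (by omega)
  have h3 := hx.pathSum i j hi (by omega) hj (by omega)
  simp only [Paper.darboux]
  positivity

lemma casorati_zero (x : ℤ × ℤ → ℝ) {c : ℤ} (hc : 1 ≤ c) (i : ℤ) : casorati x c i 0 = 0 := by
  rw [casorati, pathSum_eq_zero x (p := (1, 1)) (q := (i, 0)),
    pathSum_eq_zero x (p := (1, c + 1)) (q := (i, 0))]
  · simp
  · simp only [Prod.mk_le_mk]
    omega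
  · simp

lemma casorati_one {a b c j : ℤ} {x : ℤ × ℤ → ℝ} (hx : PosOn a b x) (ha : 1 ≤ a) (hj : 1 ≤ j)
    (hjb : j < b) : casorati x c 1 j = if j = c then 1 else 0 := by
  have hy := hx.pathSum 1 j le_rfl ha hj hjb.le
  have hxj := hx 1 (j + 1) le_rfl ha (by omega) (by omega)
  have hyj : pathSum x (1, 1) (1, j + 1) = x (1, j + 1) * pathSum x (1, 1) (1, j) := by
    rw [pathSum_step x (by simp; omega), pathSum_eq_zero x (q := up (1, j + 1)) (by simp)]
    simp [left]
  have hlt : ∀ m, m ≤ c → pathSum x (1, c + 1) (1, m) = 0 := fun m hm =>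
    pathSum_eq_zero x (by simp; omega)
  rw [casorati, hyj]
  split_ifs with h
  · subst h
    rw [pathSum_self, hlt j le_rfl]
    field_simp
    ring
  · rcases lt_or_gt_of_ne h with h | h
    · rw [hlt j h.le, hlt (j + 1) (by omega)]
      simp
    · rw [pathSum_step x (p := (1, c + 1)) (q := (1, j + 1)) (by simp; omega),
        pathSum_eq_zero x (q := up (1, j + 1)) (by simp)]
      simp only [left, add_sub_cancel_right]
      field_simp
      ring

lemma casorati_recursion {X Y y00 y10 y01 y11 y1m f00 f10 f01 f11 f1m : ℝ} (hX : X ≠ 0) (hY : Y ≠ 0)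
    (h00 : 0 < y00) (h10 : 0 < y10) (h01 : 0 < y01)
    (hy10 : y10 = X * (y00 + y1m)) (hf10 : f10 = X * (f00 + f1m))
    (hy11 : y11 = Y * (y01 + y10)) (hf11 : f11 = Y * (f01 + f10)) :
    f11 * y10 / y11 - f10 = (y10⁻¹ + y01⁻¹)⁻¹ / y00 *
      ((f01 * y00 / y01 - f00) + (f10 * y1m / y10 - f1m)) := by
  have h1 : f1m = f10 / X - f00 := by
    rw [hf10]; field_simp; ring
  have h2 : y1m = y10 / X - y00 := by
    rw [hy10]; field_simp; ring
  have h3 : y01 + y10 ≠ 0 := by positivity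
  have h4 : y10 + y01 ≠ 0 := by positivity
  rw [hy11, hf11, h1, h2]
  field_simp
  ring

lemma pathSum_darboux {a b c : ℤ} {x : ℤ × ℤ → ℝ} (hx : PosOn a b x) (hc : 1 ≤ c) {i j : ℤ}
    (hi : 1 ≤ i) (hia : i < a) (hj : 1 ≤ j) (hjb : j < b) :
    pathSum (darboux x) (1, c) (i, j) = casorati x c (i + 1) j := by
  refine (gridRec_unique (a := a - 1) (b := b - 1) (G := fun i j => casorati x c (i + 1) j) hc ?_ hi
    (by omega) hj (by omega)).symm
  intro i j hi hia hj hjb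
  have h1 : (if i = 1 then (if j = c then 1 else 0) else casorati x c (i - 1 + 1) j) =
      casorati x c i j := by
    split_ifs with h h'
    · rw [h, casorati_one hx (by omega) hj (by omega), if_pos h']
    · rw [h, casorati_one hx (by omega) hj (by omega), if_neg h']
    · simp
  have h2 : (if j = 1 then 0 else casorati x c (i + 1) (j - 1)) = casorati x c (i + 1) (j - 1) := by
    split_ifs with h
    · rw [h, sub_self, casorati_zero x hc]
    · rfl
  simp only [gridRec, h1, h2]
  have hstep : ∀ c j : ℤ, pathSum x (1, c) (i + 1, j) =
      x (i + 1, j) * (pathSum x (1, c) (i, j) + pathSum x (1, c) (i + 1, j - 1)) := by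
    intro c j
    rw [pathSum_step x (by simp; omega)]
    simp [up]
  have hstep' := fun c => hstep c (j + 1)
  simp only [add_sub_cancel_right] at hstep'
  simp only [casorati, darboux, sub_add_cancel]
  exact casorati_recursion (hx (i + 1) j (by omega) (by omega) hj (by omega)).ne'
    (hx (i + 1) (j + 1) (by omega) (by omega) (by omega) (by omega)).ne'
    (hx.pathSum i j hi (by omega) hj (by omega))
    (hx.pathSum (i + 1) j (by omega) (by omega) hj (by omega))
    (hx.pathSum i (j + 1) hi (by omega) (by omega) (by omega))
    (hstep 1 j) (hstep (c + 1) j) (hstep' 1) (hstep' (c + 1))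

lemma pathSum_last_row {a b c : ℤ} {x z : ℤ × ℤ → ℝ} (hx : PosOn a b x) (hc : 1 ≤ c)
    (hz : ∀ i j, 1 ≤ i → i < a → 1 ≤ j → j < b → z (i, j) = darboux x (i, j))
    (hza : ∀ j, 1 ≤ j → j < b →
      z (a, j) = pathSum x (1, 1) (a, j + 1) / pathSum x (1, 1) (a, j)) {j : ℤ}
    (ha : 1 ≤ a) (hj : 1 ≤ j) (hjb : j < b) :
    pathSum z (1, c) (a, j) = pathSum x (1, c + 1) (a, j + 1) := by
  refine (gridRec_unique (a := a) (b := b - 1)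
    (G := fun i j => if i = a then pathSum x (1, c + 1) (a, j + 1) else pathSum z (1, c) (i, j))
    hc ?_ ha le_rfl hj (by omega)).symm.trans (if_pos rfl)
  intro i j hi hia hj hjb
  by_cases h : i = a
  · subst h
    have h1 : (if i = 1 then (if j = c then 1 else 0) else
        if i - 1 = i then pathSum x (1, c + 1) (i, j + 1) else pathSum z (1, c) (i - 1, j)) =
        casorati x c i j := by
      split_ifs with h h' h'
      · rw [h, casorati_one (hx.mono le_rfl le_rfl) (by omega) hj (by omega), if_pos h']
      · rw [h, casorati_one hx (by omega) hj (by omega), if_neg h']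
      · omega
      · rw [pathSum_congr (x' := darboux x), pathSum_darboux hx hc (by omega) (by omega) hj (by omega),
          sub_add_cancel]
        intro v hv hv'
        rw [Prod.le_def] at hv hv'
        simp only at hv hv'
        exact hz v.1 v.2 (by omega) (by omega) (by omega) (by omega)
    have h2 : (if j = 1 then 0 else pathSum x (1, c + 1) (i, j - 1 + 1)) =
        pathSum x (1, c + 1) (i, j) := by
      split_ifs with h
      · rw [h, pathSum_eq_zero]
        simp only [Prod.mk_le_mk]
        omega
      · simp
    simp only [gridRec, if_true, h1, h2, hza j hj (by omega), casorati]
    have := hx.pathSum i j hi le_rfl hj (by omega)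
    have := hx.pathSum i (j + 1) hi le_rfl (by omega) (by omega)
    field_simp
    ring
  · have h' : ¬ i - 1 = a := by omega
    simp only [if_neg h, gridRec, if_neg h']
    exact pathSum_gridRec hc z hi

lemma pathDet_succ {a b : ℤ} {x : ℤ × ℤ → ℝ} (hx : PosOn a b x) (k : ℕ) (hka : (k : ℤ) < a)
    (hkb : (k : ℤ) < b) :
    pathDet x 1 1 a b (k + 1) =
      pathSum x (1, 1) (a, b) * pathDet (darboux x) 1 1 (a - 1) (b - 1) k := by
  set Y : Fin (k + 1) → ℝ := fun q => pathSum x (1, 1) (a, b - k + (q : ℕ)) with hYdef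
  have hY : ∀ q, 0 < Y q := fun q => by
    have := q.2
    exact hx.pathSum a _ (by omega) le_rfl (by omega) (by omega)
  set A : Matrix (Fin (k + 1)) (Fin (k + 1)) ℝ := Matrix.of fun p q =>
    pathSum x (1, 1 + (p : ℕ)) (a, b - k + (q : ℕ)) with hA
  have hdet : pathDet x 1 1 a b (k + 1) = A.det := by
    unfold pathDet
    congr 1
    ext p q
    simp only [pathMatrix, rowPoints, hA, Matrix.of_apply]
    congr 2
    push_cast
    ring
  set A' : Matrix (Fin (k + 1)) (Fin (k + 1)) ℝ := Matrix.of fun p q => (Y q)⁻¹ * A p q with hA'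
  have h1 : A'.det = (∏ q, (Y q)⁻¹) * A.det := Matrix.det_mul_row _ _
  set C := pathMatrix (darboux x) (rowPoints k 1 1) (rowPoints k (a - 1) (b - 1 - k + 1)) with hC
  set B : Matrix (Fin (k + 1)) (Fin (k + 1)) ℝ := Matrix.of fun p q =>
    (Fin.cons (A' p 0) (fun j : Fin k => A' p j.succ - A' p j.castSucc) : Fin (k + 1) → ℝ) q
    with hB
  have h2 : A'.det = B.det := by
    refine Matrix.det_eq_of_forall_col_eq_smul_add_pred (fun _ => 1) ?_ ?_
    · intro i
      simp [hB]
    · intro i j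
      simp [hB]
  have hrow : ∀ q, A' 0 q = 1 := by
    intro q
    have := (hY q).ne'
    simp only [hA', hA, Matrix.of_apply, Fin.val_zero, Nat.cast_zero, add_zero]
    exact inv_mul_cancel₀ this
  have h3 : B.det = (B.submatrix Fin.succ Fin.succ).det := by
    rw [Matrix.det_succ_row_zero, Fin.sum_univ_succ, Finset.sum_eq_zero]
    · have : B 0 0 = 1 := by simp [hB, hrow]
      simp [this]
    · intro j _
      have : B 0 j.succ = 0 := by simp [hB, hrow]
      simp [this]
  have h4 : B.submatrix Fin.succ Fin.succ =
      Matrix.of fun i j => (Y (Fin.castSucc j))⁻¹ * C i j := by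
    ext i j
    have hj := j.2
    have e1 := hY j.castSucc
    have e2 := hY j.succ
    have hcas : C i j = casorati x (1 + (i : ℕ)) a (b - k + (j : ℕ)) := by
      have := pathSum_darboux hx (c := 1 + (i : ℕ)) (i := a - 1) (j := b - k + (j : ℕ)) (by omega)
        (by omega) (by omega) (by omega) (by omega)
      rw [sub_add_cancel] at this
      rw [← this]
      simp only [hC, pathMatrix, rowPoints, Matrix.of_apply]
      congr 2
      ring
    have e3 : Y j.succ = pathSum x (1, 1) (a, b - k + (j : ℕ) + 1) := by
      simp only [hYdef, Fin.val_succ]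
      congr 2
      push_cast
      ring_nf
    have e4 : Y j.castSucc = pathSum x (1, 1) (a, b - k + (j : ℕ)) := by
      simp [hYdef]
    have e5 : A i.succ j.succ = pathSum x (1, 1 + (i : ℕ) + 1) (a, b - k + (j : ℕ) + 1) := by
      simp only [hA, Matrix.of_apply, Fin.val_succ]
      congr 2
      push_cast
      ring_nf
    have e6 : A i.succ j.castSucc = pathSum x (1, 1 + (i : ℕ) + 1) (a, b - k + (j : ℕ)) := by
      simp only [hA, Matrix.of_apply, Fin.val_succ, Fin.val_castSucc]
      congr 2
    rw [Matrix.of_apply, hcas, casorati, ← e3, ← e4, ← e5, ← e6]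
    simp only [Matrix.submatrix_apply, hB, Matrix.of_apply, Fin.cons_succ, hA']
    field_simp
  have h5 : (B.submatrix Fin.succ Fin.succ).det = (∏ q : Fin k, (Y q.castSucc)⁻¹) * C.det := by
    rw [h4]
    exact Matrix.det_mul_row _ _
  have h6 : (∏ q, (Y q)⁻¹) * A.det = (∏ q : Fin k, (Y q.castSucc)⁻¹) * C.det := by
    rw [← h1, h2, h3, h5]
  rw [Fin.prod_univ_castSucc, mul_assoc] at h6
  have h7 := mul_left_cancel₀ (Finset.prod_ne_zero_iff.2 fun q _ => inv_ne_zero (hY _).ne') h6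
  have h8 : Y (Fin.last k) = pathSum x (1, 1) (a, b) := by simp [hYdef]
  rw [hdet, ← h8, pathDet, ← hC, ← h7, mul_inv_cancel_left₀ (hY _).ne']

lemma pathSum_one_swap (x : ℤ × ℤ → ℝ) (q : ℤ × ℤ) :
    pathSum (fun v => x v.swap) (1, 1) q = pathSum x (1, 1) q.swap :=
  pathSum_swap x (1, 1) q

lemma darboux_swap (x : ℤ × ℤ → ℝ) :
    darboux (fun v => x v.swap) = fun v => darboux x v.swap := by
  funext q
  simp only [darboux, pathSum_one_swap, Prod.swap_prod_mk, Prod.fst_swap, Prod.snd_swap]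
  rw [add_comm]

lemma pathDet_translate (x : ℤ × ℤ → ℝ) (d : ℤ × ℤ) (i₁ j₁ i₂ j₂ : ℤ) (k : ℕ) :
    pathDet (fun v => x (v + d)) i₁ j₁ i₂ j₂ k =
      pathDet x (i₁ + d.1) (j₁ + d.2) (i₂ + d.1) (j₂ + d.2) k := by
  unfold pathDet
  congr 1
  ext p q
  simp only [pathMatrix, Matrix.of_apply, pathSum_translate, rowPoints]
  congr 1
  · ext <;> simp
    ring
  · ext <;> simp
    ring

lemma pathDet_swap {a b : ℤ} {x : ℤ × ℤ → ℝ} (hx : PosOn a b x) (k : ℕ) (hka : (k : ℤ) ≤ a)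
    (hkb : (k : ℤ) ≤ b) :
    pathDet (fun v => x v.swap) 1 1 b a k = pathDet x 1 1 a b k := by
  induction k generalizing a b x with
  | zero => simp [pathDet]
  | succ k ih =>
    push_cast at hka hkb
    rw [pathDet_succ hx k (by omega) (by omega), pathDet_succ (a := b) (b := a)
      (fun i j hi hi' hj hj' => hx j i hj hj' hi hi') k (by omega) (by omega), darboux_swap,
      ih hx.darboux (by omega) (by omega), pathSum_one_swap]
    rfl

lemma rectList_eq (a b : ℕ) :
    rectList a b = (List.range a).reverse.flatMap fun i : ℕ =>
      (List.range b).reverse.map fun j : ℕ => ((i : ℤ) + 1, (j : ℤ) + 1) := by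
  simp only [rectList, bind_pure_comp, List.map_eq_map, List.flatMap_map, List.map_map]
  rfl

lemma mem_rectList {a b : ℕ} {p : ℤ × ℤ} : p ∈ rectList a b ↔ inR a b p := by
  obtain ⟨i, j⟩ := p
  simp only [rectList_eq, List.mem_flatMap, List.mem_reverse, List.mem_range, List.mem_map,
    Prod.mk.injEq, inR]
  constructor
  · rintro ⟨i', hi', j', hj', rfl, rfl⟩
    omega
  · rintro ⟨h1, h2, h3, h4⟩
    exact ⟨(i - 1).toNat, by omega, (j - 1).toNat, by omega, by omega, by omega⟩

/-- The strict lexicographic order on pairs of integers. -/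
def LexLT (p q : ℤ × ℤ) : Prop := p.1 < q.1 ∨ p.1 = q.1 ∧ p.2 < q.2

lemma pairwise_rectList_reverse (a b : ℕ) : (rectList a b).reverse.Pairwise LexLT := by
  rw [List.pairwise_reverse, rectList_eq, List.pairwise_flatMap]
  constructor
  · intro i _
    rw [List.pairwise_map, List.pairwise_reverse]
    exact List.pairwise_lt_range.imp fun h => Or.inr ⟨rfl, by simpa using h⟩
  · rw [List.pairwise_reverse]
    refine List.pairwise_lt_range.imp fun h p hp q hq => Or.inl ?_
    simp only [List.mem_map] at hp hq
    obtain ⟨_, _, rfl⟩ := hp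
    obtain ⟨_, _, rfl⟩ := hq
    simpa using h

section Toggles

variable {r s : ℕ} {y y' : ℤ × ℤ → ℝ} {p q : ℤ × ℤ}

lemma mem_upSet : q ∈ upSet r s p ↔ (q = (p.1 + 1, p.2) ∨ q = (p.1, p.2 + 1)) ∧ inR r s q := by
  simp [upSet]

lemma mem_downSet :
    q ∈ downSet r s p ↔ (q = (p.1 - 1, p.2) ∨ q = (p.1, p.2 - 1)) ∧ inR r s q := by
  simp [downSet]

lemma LexLT_of_mem_upSet (h : q ∈ upSet r s p) : LexLT p q := by
  rcases (mem_upSet.1 h).1 with rfl | rfl <;> simp [LexLT]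

lemma LexLT_of_mem_downSet (h : q ∈ downSet r s p) : LexLT q p := by
  rcases (mem_downSet.1 h).1 with rfl | rfl <;> simp [LexLT]

lemma LexLT.asymm (h : LexLT p q) : ¬ LexLT q p := by
  unfold LexLT at *
  omega

lemma LexLT.ne (h : LexLT p q) : p ≠ q := by
  rintro rfl
  exact h.asymm h

lemma usum_congr (h : ∀ q ∈ upSet r s p, y q = y' q) : usum r s y p = usum r s y' p := by
  rw [usum, usum, Finset.sum_congr rfl fun q hq => by rw [h q hq]]

lemma dsum_congr (h : ∀ q ∈ downSet r s p, y q = y' q) : dsum r s y p = dsum r s y' p := by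
  rw [dsum, dsum, Finset.sum_congr rfl h]

lemma foldl_toggle_of_notMem {L : List (ℤ × ℤ)} (h : p ∉ L) :
    L.foldl (fun y p => toggle r s p y) y p = y p := by
  induction L generalizing y with
  | nil => rfl
  | cons a L ih =>
    rw [List.mem_cons, not_or] at h
    rw [List.foldl_cons, ih h.2, toggle, if_neg h.1]

lemma foldl_toggle_of_mem {L : List (ℤ × ℤ)} (hL : L.Pairwise LexLT) (h : p ∈ L) :
    L.foldl (fun y p => toggle r s p y) y p =
      usum r s y p * dsum r s (L.foldl (fun y p => toggle r s p y) y) p / y p := by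
  induction L generalizing y with
  | nil => cases h
  | cons a L ih =>
    rw [List.pairwise_cons] at hL
    rcases List.mem_cons.1 h with rfl | h
    · have hp : p ∉ L := fun hp => (hL.1 p hp).ne rfl
      rw [dsum_congr (y := List.foldl _ _ _) (y' := y), List.foldl_cons, foldl_toggle_of_notMem hp,
        toggle, if_pos rfl]
      intro q hq
      have hqp := LexLT_of_mem_downSet hq
      refine foldl_toggle_of_notMem fun hq' => ?_
      rcases List.mem_cons.1 hq' with rfl | hq'
      · exact hqp.ne rfl
      · exact hqp.asymm (hL.1 q hq')
    · rw [List.foldl_cons, ih hL.2 h]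
      have hap := hL.1 p h
      congr 1
      · congr 1
        refine usum_congr fun q hq => ?_
        rw [toggle, if_neg]
        rintro rfl
        exact (LexLT_of_mem_upSet hq).asymm hap
      · rw [toggle, if_neg hap.ne.symm]

lemma usum_pos (hy : ∀ p, inR r s p → 0 < y p) (p : ℤ × ℤ) : 0 < usum r s y p := by
  unfold usum
  split_ifs with h
  · exact inv_pos.2 (Finset.sum_pos (fun q hq => inv_pos.2 (hy q (mem_upSet.1 hq).2)) h)
  · exact one_pos

lemma dsum_pos (hy : ∀ p, inR r s p → 0 < y p) (p : ℤ × ℤ) : 0 < dsum r s y p := by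
  unfold dsum
  split_ifs with h
  · exact Finset.sum_pos (fun q hq => hy q (mem_downSet.1 hq).2) h
  · exact one_pos

lemma foldl_toggle_pos (hy : ∀ p, inR r s p → 0 < y p) (L : List (ℤ × ℤ)) :
    ∀ p, inR r s p → 0 < L.foldl (fun y p => toggle r s p y) y p := by
  induction L generalizing y with
  | nil => exact hy
  | cons a L ih =>
    refine ih fun p hp => ?_
    simp only [toggle]
    split_ifs with h
    · subst h
      exact div_pos (mul_pos (usum_pos hy p) (dsum_pos hy p)) (hy p hp)
    · exact hy p hp

lemma foldl_toggle_congr {r' s' : ℕ} {L : List (ℤ × ℤ)}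
    (hL : ∀ p ∈ L, upSet r s p = upSet r' s' p ∧ downSet r s p = downSet r' s' p)
    (hy : ∀ p, inR r' s' p → y p = y' p) :
    ∀ p, inR r' s' p → L.foldl (fun y p => toggle r s p y) y p =
      L.foldl (fun y p => toggle r' s' p y) y' p := by
  induction L generalizing y y' with
  | nil => exact hy
  | cons a L ih =>
    refine ih (fun p hp => hL p (List.mem_cons_of_mem _ hp)) fun p hp => ?_
    obtain ⟨hu, hd⟩ := hL a List.mem_cons_self
    simp only [toggle]
    split_ifs with h
    · subst h
      rw [hy p hp, usum, dsum, hu, hd, ← usum, ← dsum,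
        usum_congr fun q hq => hy q (mem_upSet.1 hq).2,
        dsum_congr fun q hq => hy q (mem_downSet.1 hq).2]
    · exact hy p hp

lemma dsum_eq {i j : ℤ} (h : inR r s (i, j)) :
    dsum r s y (i, j) = (if i = 1 then (if j = 1 then 1 else 0) else y (i - 1, j)) +
      (if j = 1 then 0 else y (i, j - 1)) := by
  simp only [inR] at h
  have h1 : inR r s (i - 1, j) ↔ ¬ i = 1 := by simp only [inR]; omega
  have h2 : inR r s (i, j - 1) ↔ ¬ j = 1 := by simp only [inR]; omega
  simp only [dsum, downSet, Finset.filter_insert, Finset.filter_singleton, h1, h2]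
  by_cases hi : i = 1 <;> by_cases hj : j = 1 <;> simp [hi, hj]

lemma usum_interior {i j : ℤ} (hi : 1 ≤ i) (hir : i < r) (hj : 1 ≤ j) (hjs : j < s) :
    usum r s y (i, j) = ((y (i + 1, j))⁻¹ + (y (i, j + 1))⁻¹)⁻¹ := by
  have h1 : inR r s (i + 1, j) := by simp only [inR]; omega
  have h2 : inR r s (i, j + 1) := by simp only [inR]; omega
  simp [usum, upSet, Finset.filter_insert, Finset.filter_singleton, h1, h2]

lemma usum_last_row {j : ℤ} (hr : 1 ≤ r) (hj : 1 ≤ j) (hjs : j < s) :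
    usum r s y (r, j) = y (r, j + 1) := by
  have h1 : ¬ inR r s (r + 1, j) := by simp only [inR]; omega
  have h2 : inR r s (r, j + 1) := by simp only [inR]; omega
  simp [usum, upSet, Finset.filter_insert, Finset.filter_singleton, h1, h2]

lemma usum_last_col {i : ℤ} (hs : 1 ≤ s) (hi : 1 ≤ i) (hir : i < r) :
    usum r s y (i, s) = y (i + 1, s) := by
  have h1 : inR r s (i + 1, s) := by simp only [inR]; omega
  have h2 : ¬ inR r s (i, s + 1) := by simp only [inR]; omega
  simp [usum, upSet, Finset.filter_insert, Finset.filter_singleton, h1, h2]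

end Toggles

lemma upSet_pred {r s : ℕ} {p : ℤ × ℤ} (h1 : p.1 + 2 ≤ r) (h2 : p.2 + 2 ≤ s) :
    upSet r s p = upSet (r - 1) (s - 1) p := by
  refine Finset.filter_congr fun q hq => ?_
  simp only [Finset.mem_insert, Finset.mem_singleton] at hq
  rcases hq with rfl | rfl <;> simp only [inR] <;> omega

lemma downSet_pred {r s : ℕ} {p : ℤ × ℤ} (h1 : p.1 + 1 ≤ r) (h2 : p.2 + 1 ≤ s) :
    downSet r s p = downSet (r - 1) (s - 1) p := by
  refine Finset.filter_congr fun q hq => ?_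
  simp only [Finset.mem_insert, Finset.mem_singleton] at hq
  rcases hq with rfl | rfl <;> simp only [inR] <;> omega

lemma RSKaux_succ_eq {r s : ℕ} {y y' : ℤ × ℤ → ℝ}
    (h : ∀ p, inR (r - 1) (s - 1) p → rhoIInv r s (r - 1) (s - 1) y p = y' p) (t : ℕ) :
    ∀ p, inR (r - 1) (s - 1) p → RSKaux r s (t + 1) y p = RSKaux (r - 1) (s - 1) t y' p := by
  induction t with
  | zero => exact h
  | succ t ih =>
    simp only [RSKaux] at ih ⊢
    rw [show r - 1 - (t + 1) = r - (t + 1 + 1) by omega,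
      show s - 1 - (t + 1) = s - (t + 1 + 1) by omega]
    refine foldl_toggle_congr (fun p hp => ?_) ih
    have hp' := mem_rectList.1 (List.mem_reverse.1 hp)
    simp only [inR] at hp'
    exact ⟨upSet_pred (by omega) (by omega), downSet_pred (by omega) (by omega)⟩

lemma rhoIInv_phiInv {r s : ℕ} (x : ℤ × ℤ → ℝ) (p : ℤ × ℤ) (hp : inR (r - 1) (s - 1) p) :
    rhoIInv r s (r - 1) (s - 1) (phiInv x) p = phiInv (darboux x) p := by
  rw [phiInv_eq_pathSum (darboux x)]
  obtain ⟨i, j⟩ := p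
  have hp' := hp
  simp only [inR] at hp'
  refine gridRec_unique (a := (r - 1 : ℕ)) (b := (s - 1 : ℕ))
    (G := fun i j => rhoIInv r s (r - 1) (s - 1) (phiInv x) (i, j)) le_rfl ?_
    (by omega) (by omega) (by omega) (by omega)
  intro i j hi hi' hj hj'
  have hmem : (i, j) ∈ (rectList (r - 1) (s - 1)).reverse :=
    List.mem_reverse.2 (mem_rectList.2 ⟨hi, hi', hj, hj'⟩)
  simp only [gridRec]
  rw [← dsum_eq (r := r) (s := s) (y := rhoIInv r s (r - 1) (s - 1) (phiInv x))
    (by simp only [inR]; omega), darboux,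
    ← usum_interior (r := r) (s := s) hi (by omega) hj (by omega), ← phiInv_eq_pathSum]
  conv_lhs => rw [rhoIInv, foldl_toggle_of_mem (pairwise_rectList_reverse _ _) hmem]
  rw [← rhoIInv]
  ring

lemma RSK_eq_pred {r s : ℕ} (hr : 2 ≤ r) (hs : 2 ≤ s) (x : ℤ × ℤ → ℝ) (p : ℤ × ℤ)
    (hp : inR (r - 1) (s - 1) p) : RSK r s x p = RSK (r - 1) (s - 1) (darboux x) p := by
  rw [RSK, RSK, show min r s - 1 = min (r - 1) (s - 1) - 1 + 1 by omega]
  exact RSKaux_succ_eq (rhoIInv_phiInv x) _ p hp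

lemma RSKaux_boundary {r s : ℕ} (y : ℤ × ℤ → ℝ) {p : ℤ × ℤ} (h : p.1 = r ∨ p.2 = s) (t : ℕ)
    (ht : t ≤ min r s) : RSKaux r s t y p = y p := by
  induction t with
  | zero => rfl
  | succ t ih =>
    rw [← ih (by omega)]
    refine foldl_toggle_of_notMem fun hp => ?_
    have := mem_rectList.1 (List.mem_reverse.1 hp)
    simp only [inR] at this
    omega

/-- Entries of the birational RSK image as ratios of path determinants of a corner rectangle. -/
lemma RSK_eq_pathDet_div {r s a b : ℕ} {x : ℤ × ℤ → ℝ} (hx : PosOn a b x)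
    (h : a = r ∨ b = s) (har : a ≤ r) (hbs : b ≤ s) (t : ℕ) (hta : t < a) (htb : t < b) :
    RSK r s x ((a : ℤ) - t, (b : ℤ) - t) =
      pathDet x 1 1 a b (t + 1) / pathDet x 1 1 a b t := by
  induction t generalizing r s a b x with
  | zero =>
    rw [pathDet_succ hx 0 (by simpa using hta) (by simpa using htb)]
    simp only [RSK, Nat.cast_zero, sub_zero]
    rw [RSKaux_boundary _ (by simpa using h) _ (by omega), phiInv_eq_pathSum]
    simp [pathDet]
  | succ t ih =>
    have ha : ((a - 1 : ℕ) : ℤ) = a - 1 := by omega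
    have hb : ((b - 1 : ℕ) : ℤ) = b - 1 := by omega
    have hy := hx.pathSum a b (by omega) le_rfl (by omega) le_rfl
    rw [RSK_eq_pred (by omega) (by omega) x _ (by simp only [inR]; omega),
      pathDet_succ hx (t + 1) (by omega) (by omega), pathDet_succ hx t (by omega) (by omega),
      mul_div_mul_left _ _ hy.ne', ← ha, ← hb,
      ← ih (r := r - 1) (s := s - 1) (a := a - 1) (b := b - 1) (by rw [ha, hb]; exact hx.darboux)
        (by omega) (by omega) (by omega) (by omega) (by omega), ha, hb]
    congr 2 <;> push_cast <;> ring

/-- The shifted labeling `φ ∘ ρ⁻¹ ∘ φ⁻¹`. -/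
lemma phi_rhoInv_phiInv {r s : ℕ} {x : ℤ × ℤ → ℝ} (hx : PosOn r s x) {p : ℤ × ℤ}
    (hp : inR r s p) :
    phi r s (rhoInv r s (phiInv x)) p = usum r s (pathSum x (1, 1)) p / pathSum x (1, 1) p := by
  have hy : ∀ p, inR r s p → 0 < pathSum x (1, 1) p :=
    fun p hp => hx.pathSum p.1 p.2 hp.1 hp.2.1 hp.2.2.1 hp.2.2.2
  have hd := dsum_pos (foldl_toggle_pos hy (rectList r s).reverse) p
  rw [phi, phiInv_eq_pathSum, rhoInv,
    foldl_toggle_of_mem (pairwise_rectList_reverse r s)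
      (List.mem_reverse.2 (mem_rectList.2 hp)),
    mul_div_right_comm, mul_div_cancel_right₀ _ hd.ne']

/-- A labeling of a rectangle agreeing with `φ ∘ ρ⁻¹ ∘ φ⁻¹` of `x` away from the maximum. -/
structure IsShift (a b : ℤ) (x z : ℤ × ℤ → ℝ) : Prop where
  interior : ∀ i j, 1 ≤ i → i < a → 1 ≤ j → j < b → z (i, j) = darboux x (i, j)
  last_row : ∀ j, 1 ≤ j → j < b →
    z (a, j) = pathSum x (1, 1) (a, j + 1) / pathSum x (1, 1) (a, j)
  last_col : ∀ i, 1 ≤ i → i < a →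
    z (i, b) = pathSum x (1, 1) (i + 1, b) / pathSum x (1, 1) (i, b)

lemma IsShift.swap {a b : ℤ} {x z : ℤ × ℤ → ℝ} (h : IsShift a b x z) :
    IsShift b a (fun v => x v.swap) (fun v => z v.swap) where
  interior i j hi hi' hj hj' := by
    rw [darboux_swap]
    exact h.interior j i hj hj' hi hi'
  last_row j hj hj' := by
    simp only [pathSum_one_swap]
    exact h.last_col j hj hj'
  last_col i hi hi' := by
    simp only [pathSum_one_swap]
    exact h.last_row i hi hi'

lemma IsShift.pathDet_col {a b : ℤ} {x z : ℤ × ℤ → ℝ} (h : IsShift a b x z) (hx : PosOn a b x)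
    (ha : 1 ≤ a) {J : ℤ} (hJ : J < b) (k : ℕ) (hk : (k : ℤ) ≤ J) :
    pathDet z 1 1 a J k = pathDet x 1 2 a (J + 1) k := by
  unfold pathDet
  congr 1
  ext p q
  have := q.2
  simp only [pathMatrix, Matrix.of_apply, rowPoints]
  rw [pathSum_last_row hx (by omega) h.interior h.last_row ha (by omega) (by omega)]
  congr 2 <;> ring

lemma IsShift.pathDet_row {a b : ℤ} {x z : ℤ × ℤ → ℝ} (h : IsShift a b x z) (hx : PosOn a b x)
    (hz : PosOn a b z) (hb : 1 ≤ b) {I : ℤ} (hI : I < a) (k : ℕ) (hk : (k : ℤ) ≤ I)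
    (hkb : (k : ℤ) ≤ b) :
    pathDet z 1 1 I b k = pathDet x 2 1 (I + 1) b k := by
  have hx' : PosOn I b fun v => x (v + (1, 0)) := by
    intro i j hi hi' hj hj'
    simpa using hx (i + 1) j (by omega) (by omega) hj hj'
  have e1 := pathDet_translate x (1, 0) 1 1 I b k
  have e2 := pathDet_swap hx' k hk hkb
  have e3 := pathDet_translate (fun v => x v.swap) (0, 1) 1 1 b I k
  have e4 := h.swap.pathDet_col (fun i j hi hi' hj hj' => hx j i hj hj' hi hi') hb hI k hk
  have e5 := pathDet_swap (hz.mono hI.le le_rfl) k hk hkb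
  norm_num at e1 e3
  rw [← e5, e4, ← e1, ← e2, ← e3]

lemma isShift_phi_rhoInv_phiInv {r s : ℕ} (hr : 1 ≤ r) (hs : 1 ≤ s) {x : ℤ × ℤ → ℝ}
    (hx : PosOn r s x) : IsShift r s x (phi r s (rhoInv r s (phiInv x))) where
  interior i j hi hi' hj hj' := by
    rw [phi_rhoInv_phiInv hx (by simp only [inR]; omega), usum_interior hi hi' hj hj', darboux]
  last_row j hj hj' := by
    rw [phi_rhoInv_phiInv hx (by simp only [inR]; omega), usum_last_row hr hj hj']
  last_col i hi hi' := by
    rw [phi_rhoInv_phiInv hx (by simp only [inR]; omega), usum_last_col hs hi hi']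

/-- **Corollary 5.8.** If `z` satisfies the chain-shifting property with respect to `x`
(all shifted chain sums of `z` match those of `x`, for columns and rows), then
`RSK(z)_{ij} = RSK(φ(ρ⁻¹(φ⁻¹(x))))_{ij}` for every `(i,j) ∈ R` with `j - i ≠ s - r`. -/
theorem chain_shifting_determines_RSK (r s : ℕ) (hr : 1 ≤ r) (hs : 1 ≤ s)
    (x z : ℤ × ℤ → ℝ)
    (hx : ∀ p, inR r s p → 0 < x p) (hz : ∀ p, inR r s p → 0 < z p)
    (hcol : ∀ u v : ℤ, 1 < u → u ≤ v → v ≤ (s : ℤ) → ∀ k : ℤ, 1 ≤ k →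
      w 1 r (u - 1) (v - 1) k z = w 1 r u v k x)
    (hrow : ∀ u v : ℤ, 1 < u → u ≤ v → v ≤ (r : ℤ) → ∀ k : ℤ, 1 ≤ k →
      w (u - 1) (v - 1) 1 s k z = w u v 1 s k x) :
    ∀ i j : ℤ, inR r s (i, j) → j - i ≠ (s : ℤ) - r →
      RSK r s z (i, j) = RSK r s (phi r s (rhoInv r s (phiInv x))) (i, j) := by
  have hx' : PosOn r s x := fun i j hi hi' hj hj' => hx _ ⟨hi, hi', hj, hj'⟩
  have hz' : PosOn r s z := fun i j hi hi' hj hj' => hz _ ⟨hi, hi', hj, hj'⟩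
  have hshift := isShift_phi_rhoInv_phiInv hr hs hx'
  have hZ : PosOn r s (phi r s (rhoInv r s (phiInv x))) := fun i j hi hi' hj hj' => by
    rw [phi_rhoInv_phiInv hx' ⟨hi, hi', hj, hj'⟩]
    refine div_pos (usum_pos (fun p hp => ?_) _) (hx'.pathSum i j hi hi' hj hj')
    exact hx'.pathSum p.1 p.2 hp.1 hp.2.1 hp.2.2.1 hp.2.2.2
  generalize phi r s (rhoInv r s (phiInv x)) = Z at hshift hZ ⊢
  intro i j hij hne
  obtain ⟨hi, hir, hj, hjs⟩ := hij
  simp only at hi hir hj hjs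
  rcases lt_or_gt_of_ne hne with hlt | hgt
  · obtain ⟨t, ht⟩ : ∃ t : ℕ, (t : ℤ) = r - i := ⟨(r - i).toNat, by omega⟩
    obtain ⟨b, hb⟩ : ∃ b : ℕ, (b : ℤ) = j + t := ⟨(j + t).toNat, by omega⟩
    have key : ∀ k : ℕ, k ≤ b → pathDet z 1 1 r b k = pathDet Z 1 1 r b k := by
      intro k hk
      rcases k.eq_zero_or_pos with rfl | hk0
      · simp [pathDet]
      · rw [hshift.pathDet_col hx' (by omega) (by omega) k (by omega),
          ← w_eq_pathDet _ _ _ _ _ (by omega), ← w_eq_pathDet _ _ _ _ _ (by omega),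
          ← hcol 2 (b + 1) (by omega) (by omega) (by omega) k (by omega)]
        norm_num
    rw [show i = (r : ℤ) - t by omega, show j = (b : ℤ) - t by omega,
      RSK_eq_pathDet_div (hz'.mono le_rfl (by omega)) (Or.inl rfl) le_rfl (by omega) t (by omega)
        (by omega),
      RSK_eq_pathDet_div (hZ.mono le_rfl (by omega)) (Or.inl rfl) le_rfl (by omega) t (by omega)
        (by omega), key _ (by omega), key _ (by omega)]
  · obtain ⟨t, ht⟩ : ∃ t : ℕ, (t : ℤ) = s - j := ⟨(s - j).toNat, by omega⟩
    obtain ⟨a, ha⟩ : ∃ a : ℕ, (a : ℤ) = i + t := ⟨(i + t).toNat, by omega⟩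
    have key : ∀ k : ℕ, k ≤ a → k ≤ s → pathDet z 1 1 a s k = pathDet Z 1 1 a s k := by
      intro k hk hks
      rcases k.eq_zero_or_pos with rfl | hk0
      · simp [pathDet]
      · rw [hshift.pathDet_row hx' hZ (by omega) (by omega) k (by omega) (by omega),
          ← w_eq_pathDet _ _ _ _ _ (by omega), ← w_eq_pathDet _ _ _ _ _ (by omega),
          ← hrow 2 (a + 1) (by omega) (by omega) (by omega) k (by omega)]
        norm_num
    rw [show i = (a : ℤ) - t by omega, show j = (s : ℤ) - t by omega,
      RSK_eq_pathDet_div (hz'.mono (by omega) le_rfl) (Or.inr rfl) (by omega) le_rfl t (by omega)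
        (by omega),
      RSK_eq_pathDet_div (hZ.mono (by omega) le_rfl) (Or.inr rfl) (by omega) le_rfl t (by omega)
        (by omega), key _ (by omega) (by omega), key _ (by omega) (by omega)]

end Paper
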